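/- arXiv:0906.2424 — 3 statements merged into one kernel-verified Lean document; each statement's English description precedes it below -/
import Mathlib

section
/- Let S ⊆ ℂ × ℂ be the compact set S = {(u,z) : u ∈ [0,1/2] ⊆ ℝ ⊆ ℂ, |z| ≤ 1} ∪ {(u,z) : u ∈ [1/2,1] ⊆ ℝ ⊆ ℂ, 1/2 ≤ |z| ≤ 1} (a thin Hartogs figure: the fiber over u ∈ [0,1/2] is the closed unit disc, the fiber over u ∈ [1/2,1] is the closed annulus {1/2 ≤ |z| ≤ 1}). Then S is not a Stein compactum in ℂ²: there exists an open set U ⊆ ℂ² containing S such that no Stein open set Ω satisfies S ⊆ Ω ⊆ U. -/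
open Set Topology

noncomputable section

/-- The `𝒪(Ω)`-hull of a set `K` inside `Ω`: points of `Ω` where every function
holomorphic on `Ω` is bounded by its sup over `K`. -/
def hullO {E : Type*} [NormedAddCommGroup E] [NormedSpace ℂ E] (Ω K : Set E) : Set E :=
  {z ∈ Ω | ∀ f : E → ℂ, DifferentiableOn ℂ f Ω → ‖f z‖ ≤ ⨆ w ∈ K, ‖f w‖}

/-- An open set is Stein if the `𝒪(Ω)`-hull of every compact subset is compact. -/
def IsSteinOpen {E : Type*} [NormedAddCommGroup E] [NormedSpace ℂ E] (Ω : Set E) : Prop :=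
  IsOpen Ω ∧ ∀ K : Set E, K ⊆ Ω → IsCompact K → IsCompact (hullO Ω K)

/-- A compact set is a Stein compactum if every open neighborhood contains a
Stein open neighborhood. -/
def IsSteinCompactum {E : Type*} [NormedAddCommGroup E] [NormedSpace ℂ E] (S : Set E) : Prop :=
  ∀ U : Set E, IsOpen U → S ⊆ U → ∃ Ω : Set E, IsSteinOpen Ω ∧ S ⊆ Ω ∧ Ω ⊆ U

/-- `ℝⁿ` viewed as the real subspace of `ℂⁿ`. -/
def realSlice (n : ℕ) : Set (EuclideanSpace ℂ (Fin n)) := {x | ∀ i, (x i).im = 0}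

/-- The fiber of a subset of a product over a point of the first factor. -/
def fiberOf {α β : Type*} (S : Set (α × β)) (u : α) : Set β := {z | (u, z) ∈ S}

/-- A subset of `ℝⁿ × ℂᵐ` that is open in the subspace topology of `ℝⁿ × ℂᵐ ⊆ ℂⁿ × ℂᵐ`. -/
def OpenInSlice {n m : ℕ}
    (U : Set (EuclideanSpace ℂ (Fin n) × EuclideanSpace ℂ (Fin m))) : Prop :=
  ∃ W, IsOpen W ∧ U = W ∩ (realSlice n ×ˢ (univ : Set (EuclideanSpace ℂ (Fin m))))

/-- Maximum principle on a vertical disc contained in `Ω`. -/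
lemma disc_subset_hull (Ω : Set (ℂ × ℂ)) (hΩ : IsOpen Ω) (K : Set (ℂ × ℂ)) (hK : IsCompact K)
    (hKΩ : K ⊆ Ω) (t : ℂ) (hc : ∀ z ∈ Metric.sphere (0:ℂ) 1, (t, z) ∈ K)
    (hd : ∀ z ∈ Metric.closedBall (0:ℂ) 1, (t, z) ∈ Ω) :
    ∀ z ∈ Metric.closedBall (0:ℂ) 1, (t, z) ∈ hullO Ω K := by
  intro z hz
  refine ⟨hd z hz, fun f hf => ?_⟩
  have hcont : ContinuousOn (fun w => ‖f w‖) K := (hf.continuousOn.mono hKΩ).norm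
  obtain ⟨M, hM⟩ := (hK.image_of_continuousOn hcont).bddAbove
  have hM' : ∀ w ∈ K, ‖f w‖ ≤ M := fun w hw => hM ⟨w, hw, rfl⟩
  have hle : ∀ w ∈ K, ‖f w‖ ≤ ⨆ w ∈ K, ‖f w‖ := by
    intro w hw
    have hb : BddAbove (range fun w => ⨆ (_ : w ∈ K), ‖f w‖) := by
      refine ⟨max M 0, ?_⟩
      rintro _ ⟨v, rfl⟩
      by_cases hv : v ∈ K
      · simp [hv, hM' v hv]
      · simp [hv]
    have := le_ciSup hb w
    simpa [hw] using this
  have hg : DifferentiableOn ℂ (fun z : ℂ => f (t, z)) (Metric.closedBall 0 1) := by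
    refine hf.comp (f := fun z : ℂ => (t, z)) ?_ hd
    exact ((differentiable_const t).prodMk differentiable_id).differentiableOn
  have hg' : DiffContOnCl ℂ (fun z : ℂ => f (t, z)) (Metric.ball 0 1) := by
    apply DifferentiableOn.diffContOnCl
    rwa [closure_ball (0:ℂ) one_ne_zero]
  refine Complex.norm_le_of_forall_mem_frontier_norm_le Metric.isBounded_ball hg' ?_ ?_
  · intro w hw
    rw [frontier_ball (0:ℂ) one_ne_zero] at hw
    exact hle _ (hc w hw)
  · rwa [closure_ball (0:ℂ) one_ne_zero]

/-- Example 1.2: the thin Hartogs figure (fibers over `[0,1/2]` are the closed unit disc,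
fibers over `[1/2,1]` the closed annulus `1/2 ≤ |z| ≤ 1`) is not a Stein compactum. -/
theorem thin_hartogs_figure_not_stein_compactum :
    ∃ U : Set (ℂ × ℂ), IsOpen U ∧
      (({u : ℂ | u.im = 0 ∧ u.re ∈ Set.Icc (0:ℝ) (1/2)} ×ˢ {z : ℂ | ‖z‖ ≤ 1}) ∪
       ({u : ℂ | u.im = 0 ∧ u.re ∈ Set.Icc (1/2:ℝ) 1} ×ˢ {z : ℂ | 1/2 ≤ ‖z‖ ∧ ‖z‖ ≤ 1})) ⊆ U ∧
      ¬ ∃ Ω : Set (ℂ × ℂ), IsSteinOpen Ω ∧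
        (({u : ℂ | u.im = 0 ∧ u.re ∈ Set.Icc (0:ℝ) (1/2)} ×ˢ {z : ℂ | ‖z‖ ≤ 1}) ∪
         ({u : ℂ | u.im = 0 ∧ u.re ∈ Set.Icc (1/2:ℝ) 1} ×ˢ {z : ℂ | 1/2 ≤ ‖z‖ ∧ ‖z‖ ≤ 1})) ⊆ Ω ∧
        Ω ⊆ U := by
  refine ⟨{p | p.1.re < 3/4} ∪ {p | 1/4 < ‖p.2‖}, ?_, ?_, ?_⟩
  · exact (isOpen_lt (by fun_prop) (by fun_prop)).union (isOpen_lt (by fun_prop) (by fun_prop))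
  · rintro ⟨u, z⟩ (⟨⟨_, h⟩, _⟩ | ⟨_, ⟨h, _⟩⟩)
    · left
      have := h.2
      simp only [mem_setOf_eq] at *
      linarith
    · right
      simp only [mem_setOf_eq] at *
      linarith
  · rintro ⟨Ω, ⟨hO, hS⟩, hsub, hU⟩
    let K : Set (ℂ × ℂ) := (Complex.ofReal '' Icc 0 1) ×ˢ Metric.sphere (0:ℂ) 1
    have hK : IsCompact K :=
      (isCompact_Icc.image Complex.continuous_ofReal).prod (isCompact_sphere _ _)
    have hKΩ : K ⊆ Ω := by
      rintro ⟨_, z⟩ ⟨⟨t, ht, rfl⟩, hz⟩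
      have hz1 : ‖z‖ = 1 := by simpa using hz
      apply hsub
      rcases le_total t (1/2) with h | h
      · exact Or.inl ⟨⟨by simp, by simpa using ht.1, by simpa using h⟩, hz1.le⟩
      · exact Or.inr ⟨⟨by simp, by simpa using h, by simpa using ht.2⟩,
          by rw [hz1]; norm_num, hz1.le⟩
    have key : ∀ t ∈ Icc (0:ℝ) 1, (∀ z ∈ Metric.closedBall (0:ℂ) 1, ((t:ℂ), z) ∈ Ω) →
        ∀ z ∈ Metric.closedBall (0:ℂ) 1, ((t:ℂ), z) ∈ hullO Ω K := fun t ht =>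
      disc_subset_hull Ω hO K hK hKΩ t (fun z hz => ⟨⟨t, ht, rfl⟩, hz⟩)
    have hcl : IsClosed (hullO Ω K) := (hS K hKΩ hK).isClosed
    let s : Set ℝ := {t | ∀ z ∈ Metric.closedBall (0:ℂ) 1, ((t:ℂ), z) ∈ hullO Ω K}
    have hs : IsClosed s := by
      have : s = ⋂ z ∈ Metric.closedBall (0:ℂ) 1, (fun t : ℝ => ((t:ℂ), z)) ⁻¹' hullO Ω K := by
        ext t; simp [s]
      rw [this]
      exact isClosed_biInter fun z _ => hcl.preimage (by fun_prop)
    have hI : Icc (0:ℝ) 1 ⊆ s := by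
      refine (hs.inter isClosed_Icc).Icc_subset_of_forall_mem_nhdsWithin ?_ ?_
      · refine key 0 (by simp) fun z hz => hsub (Or.inl ⟨⟨by simp, by simp⟩, by simpa using hz⟩)
      · rintro x ⟨hx, hx01⟩
        have h1 : ∀ᶠ t : ℝ in 𝓝 x, ∀ z ∈ Metric.closedBall (0:ℂ) 1, ((t:ℂ), z) ∈ Ω := by
          refine (isCompact_closedBall (0:ℂ) 1).eventually_forall_of_forall_eventually ?_
          intro z hz
          have hc : Continuous fun p : ℝ × ℂ => ((p.1 : ℂ), p.2) := by fun_prop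
          exact hc.continuousAt.eventually (hO.mem_nhds (hx z hz).1)
        filter_upwards [nhdsWithin_le_nhds h1, nhdsWithin_le_nhds (Iio_mem_nhds hx01.2),
          self_mem_nhdsWithin] with t ht ht1 ht0
        exact key t ⟨hx01.1.trans (le_of_lt ht0), le_of_lt ht1⟩ ht
    have h10 := hU ((hI (right_mem_Icc.2 zero_le_one)) 0 (by simp)).1
    rcases h10 with h | h
    · norm_num at h
    · norm_num at h
end
end

section
/- Let h : ℂᴺ → ℂᵏ be a holomorphic submersion (entire, with surjective derivative at every point), let K ⊆ ℂᵏ be a compact O(ℂᵏ)-convex set, and let P ⊆ ℝⁿ ⊆ ℂⁿ be compact. Let f : P × ℂᵏ → ℂᴺ be a continuous map such that h(f(p,x)) = x for all (p,x) ∈ P × ℂᵏ and such that x ↦ f(p,x) is holomorphic on ℂᵏ for every p ∈ P. Then the compact set Σ = {(p, f(p,x)) : p ∈ P, x ∈ K} ⊆ ℂⁿ × ℂᴺ admits, inside every open set containing Σ, an open Stein set Θ with Σ ⊆ Θ such that Σ is O(Θ)-convex. -/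
open Set Topology

noncomputable section

/-- Upper bound for the (real) iterated supremum. -/
theorem hull_bisup_le {E : Type*} {L : Set E} {g : E → ℝ} {c : ℝ} (hc : 0 ≤ c)
    (hg : ∀ w ∈ L, g w ≤ c) : (⨆ w ∈ L, g w) ≤ c :=
  Real.iSup_le (fun w => Real.iSup_le (fun hw => hg w hw) hc) hc

/-- A continuous function on a compact set is bounded by its iterated supremum. -/
theorem hull_le_bisup {E : Type*} [TopologicalSpace E] {L : Set E} (hL : IsCompact L) {g : E → ℝ}
    (hgc : ContinuousOn g L) {z : E} (hz : z ∈ L) : g z ≤ ⨆ w ∈ L, g w := by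
  obtain ⟨M, hM⟩ := hL.bddAbove_image hgc
  have hb : BddAbove (range fun w => ⨆ (_ : w ∈ L), g w) := by
    refine ⟨max M 0, ?_⟩
    rintro _ ⟨w, rfl⟩
    exact Real.iSup_le (fun hw => le_max_of_le_left (hM ⟨w, hw, rfl⟩)) (le_max_right _ _)
  have h1 := le_ciSup hb z
  simpa [hz] using h1

theorem hull_exists_lt {E : Type*} [TopologicalSpace E] {L : Set E} (hL : IsCompact L) {g : E → ℝ}
    (hgc : ContinuousOn g L) {c : ℝ} (hc : 0 < c) (hg : ∀ w ∈ L, g w < c) :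
    ∃ d, 0 ≤ d ∧ d < c ∧ ∀ w ∈ L, g w ≤ d := by
  rcases L.eq_empty_or_nonempty with rfl | hne
  · exact ⟨0, le_rfl, hc, by simp⟩
  · obtain ⟨x, hx, hmax⟩ := hL.exists_isMaxOn hne hgc
    exact ⟨max (g x) 0, le_max_right _ _, max_lt (hg x hx) hc,
      fun w hw => le_max_of_le_left (hmax hw)⟩

/-- Polyhedral neighborhoods are Stein. -/
theorem hull_polyhedron_stein {E : Type*} [NormedAddCommGroup E] [NormedSpace ℂ E] [ProperSpace E]
    {R : ℝ} (hR : 0 < R) (T : Finset (E → ℂ)) (hT : ∀ G ∈ T, Differentiable ℂ G) :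
    IsSteinOpen {z : E | ‖z‖ < R ∧ ∀ G ∈ T, ‖G z‖ < 1} := by
  constructor
  · have : {z : E | ‖z‖ < R ∧ ∀ G ∈ T, ‖G z‖ < 1} =
        {z : E | ‖z‖ < R} ∩ ⋂ G ∈ T, {z : E | ‖G z‖ < 1} := by
      ext z; simp
    rw [this]
    refine (isOpen_lt continuous_norm continuous_const).inter ?_
    exact isOpen_biInter_finset fun G hG =>
      isOpen_lt (hT G hG).continuous.norm continuous_const
  · intro L hLs hL
    obtain ⟨r, hr0, hrR, hr⟩ := hull_exists_lt hL (g := fun z => ‖z‖) continuous_norm.continuousOn hR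
      (fun w hw => (hLs hw).1)
    have hex : ∀ G : E → ℂ, ∃ d : ℝ, G ∈ T → 0 ≤ d ∧ d < 1 ∧ ∀ w ∈ L, ‖G w‖ ≤ d := by
      intro G
      by_cases hG : G ∈ T
      · obtain ⟨d, hd⟩ := hull_exists_lt hL (g := fun z => ‖G z‖)
          (hT G hG).continuous.norm.continuousOn one_pos (fun w hw => (hLs hw).2 G hG)
        exact ⟨d, fun _ => hd⟩
      · exact ⟨0, fun h => absurd h hG⟩
    choose d hd using hex
    set Θ := {z : E | ‖z‖ < R ∧ ∀ G ∈ T, ‖G z‖ < 1} with hΘ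
    set C := {z : E | ‖z‖ ≤ r} ∩ ⋂ G ∈ T, {z : E | ‖G z‖ ≤ d G} with hC
    have hCcl : IsClosed C := by
      refine (isClosed_le continuous_norm continuous_const).inter ?_
      exact isClosed_biInter fun G hG =>
        isClosed_le (hT G hG).continuous.norm continuous_const
    have hCc : IsCompact C := by
      refine (isCompact_closedBall (0 : E) r).of_isClosed_subset hCcl ?_
      intro z hz
      simpa using hz.1
    have hCΘ : C ⊆ Θ := by
      intro z hz
      refine ⟨lt_of_le_of_lt hz.1 hrR, fun G hG => ?_⟩
      have h2 := hz.2
      simp only [mem_iInter] at h2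
      exact lt_of_le_of_lt (h2 G hG) (hd G hG).2.1
    have hHC : hullO Θ L ⊆ C := by
      rintro z ⟨hz, hf⟩
      refine ⟨?_, ?_⟩
      · obtain ⟨φ, hφ, hφz⟩ := exists_dual_vector'' ℂ z
        have h1 := hf φ φ.differentiable.differentiableOn
        have h2 : (⨆ w ∈ L, ‖φ w‖) ≤ r := by
          refine hull_bisup_le hr0 fun w hw => ?_
          calc ‖φ w‖ ≤ ‖φ‖ * ‖w‖ := φ.le_opNorm w
            _ ≤ 1 * ‖w‖ := by gcongr
            _ ≤ r := by simpa using hr w hw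
        have h3 : ‖φ z‖ = ‖z‖ := by rw [hφz]; simp
        show ‖z‖ ≤ r
        linarith
      · simp only [mem_iInter]
        intro G hG
        exact (hf G (hT G hG).differentiableOn).trans
          (hull_bisup_le (hd G hG).1 (hd G hG).2.2)
    refine hCc.of_isClosed_subset ?_ hHC
    have : hullO Θ L = C ∩ ⋂ (f : E → ℂ) (_ : DifferentiableOn ℂ f Θ),
        (C ∩ (fun z => ‖f z‖) ⁻¹' Iic (⨆ w ∈ L, ‖f w‖)) := by
      ext z
      simp only [mem_inter_iff, mem_iInter, mem_preimage, mem_Iic]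
      constructor
      · intro hz
        exact ⟨hHC hz, fun f hf => ⟨hHC hz, hz.2 f hf⟩⟩
      · rintro ⟨hz, hf⟩
        exact ⟨hCΘ hz, fun f hf' => (hf f hf').2⟩
    rw [this]
    refine hCcl.inter (isClosed_iInter fun f => isClosed_iInter fun hf => ?_)
    exact ((hf.continuousOn.mono hCΘ).norm).preimage_isClosed_of_isClosed hCcl isClosed_Iic

/-- A compact set which is convex with respect to entire functions has a basis of Stein
neighborhoods in which it is holomorphically convex. -/
theorem hull_stein_nbhd {E : Type*} [NormedAddCommGroup E] [NormedSpace ℂ E] [ProperSpace E]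
    {S : Set E} (hS : IsCompact S)
    (hsep : ∀ z ∉ S, ∃ G : E → ℂ, Differentiable ℂ G ∧ (∀ w ∈ S, ‖G w‖ ≤ 1) ∧ 1 < ‖G z‖)
    (U : Set E) (hU : IsOpen U) (hSU : S ⊆ U) :
    ∃ Θ : Set E, IsSteinOpen Θ ∧ S ⊆ Θ ∧ Θ ⊆ U ∧ hullO Θ S = S := by
  classical
  obtain ⟨R, hR, hSR⟩ : ∃ R, 0 < R ∧ ∀ w ∈ S, ‖w‖ < R := by
    obtain ⟨M, hM⟩ := hS.isBounded.exists_norm_le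
    exact ⟨max M 0 + 1, by positivity, fun w hw => by
      have := hM w hw
      have := le_max_left M 0
      linarith⟩
  have hB : IsCompact (Metric.closedBall (0 : E) R \ U) := (isCompact_closedBall _ _).diff hU
  have hsep' : ∀ z : E, ∃ G : E → ℂ, Differentiable ℂ G ∧ (∀ w ∈ S, ‖G w‖ < 1) ∧
      (z ∉ S → 1 < ‖G z‖) := by
    intro z
    by_cases hz : z ∈ S
    · exact ⟨fun _ => 0, differentiable_const _, by simp, fun h => absurd hz h⟩
    · obtain ⟨G, hG, h1, h2⟩ := hsep z hz
      obtain ⟨d, hd1, hd2⟩ := exists_between h2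
      have hd0 : (0 : ℝ) < d := by linarith
      have hn : ∀ w, ‖G w / (d : ℂ)‖ = ‖G w‖ / d := by
        intro w
        rw [norm_div, Complex.norm_real, Real.norm_of_nonneg hd0.le]
      refine ⟨fun w => G w / (d : ℂ), by simpa only [div_eq_mul_inv] using hG.mul_const _, fun w hw => ?_, fun _ => ?_⟩
      · rw [hn, div_lt_one hd0]
        exact lt_of_le_of_lt (h1 w hw) hd1
      · rw [hn, one_lt_div hd0]
        exact hd2
  choose G hGd hGS hGz using hsep'
  obtain ⟨t, -, htc⟩ := hB.elim_nhds_subcover (fun z => {w | 1 < ‖G z w‖}) (by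
    intro z hz
    have hzS : z ∉ S := fun h => hz.2 (hSU h)
    exact (isOpen_lt continuous_const (hGd z).continuous.norm).mem_nhds (hGz z hzS))
  have hSΘ : S ⊆ {z : E | ‖z‖ < R ∧ ∀ g ∈ t.image G, ‖g z‖ < 1} := by
    intro w hw
    refine ⟨hSR w hw, fun g hg => ?_⟩
    obtain ⟨z, -, rfl⟩ := Finset.mem_image.1 hg
    exact hGS z w hw
  refine ⟨{z : E | ‖z‖ < R ∧ ∀ g ∈ t.image G, ‖g z‖ < 1},
    hull_polyhedron_stein hR (t.image G) ?_, hSΘ, ?_, ?_⟩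
  · intro g hg
    obtain ⟨z, -, rfl⟩ := Finset.mem_image.1 hg
    exact hGd z
  · rintro w ⟨hw, hw2⟩
    by_contra hwU
    have := htc (show w ∈ Metric.closedBall (0 : E) R \ U from ⟨by simpa using hw.le, hwU⟩)
    simp only [mem_iUnion] at this
    obtain ⟨z, hz, hzw⟩ := this
    exact absurd (hw2 (G z) (Finset.mem_image_of_mem _ hz)) (not_lt.2 (le_of_lt hzw))
  · apply Subset.antisymm
    · rintro z ⟨hz, hf⟩
      by_contra hzS
      have h1 := hf (G z) (hGd z).differentiableOn
      have h2 := hull_bisup_le (L := S) (g := fun w => ‖G z w‖) zero_le_one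
        (fun w hw => (hGS z w hw).le)
      have h3 := hGz z hzS
      linarith
    · intro z hz
      refine ⟨hSΘ hz, fun f hf => ?_⟩
      exact hull_le_bisup hS (g := fun w => ‖f w‖) (hf.continuousOn.mono hSΘ).norm hz

/-- Corollary 2.3: for a continuous family `{f_p}_{p ∈ P}` of holomorphic sections of a
holomorphic submersion `h : ℂᴺ → ℂᵏ` over a compact `𝒪(ℂᵏ)`-convex set `K`, the laminated
graph set `Σ = {(p, f_p(x)) : p ∈ P, x ∈ K}` has, inside any given neighborhood, a Stein
open neighborhood `Θ` in which `Σ` is `𝒪(Θ)`-convex. -/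
theorem laminated_graph_stein_neighborhood {n k N : ℕ}
    (h : EuclideanSpace ℂ (Fin N) → EuclideanSpace ℂ (Fin k))
    (hh : Differentiable ℂ h)
    (hsub : ∀ z, Function.Surjective (fderiv ℂ h z))
    (K : Set (EuclideanSpace ℂ (Fin k))) (hK : IsCompact K)
    (hKconv : hullO univ K = K)
    (P : Set (EuclideanSpace ℂ (Fin n))) (hPc : IsCompact P) (hPreal : P ⊆ realSlice n)
    (f : EuclideanSpace ℂ (Fin n) → EuclideanSpace ℂ (Fin k) → EuclideanSpace ℂ (Fin N))
    (hfcont : ContinuousOn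
      (fun q : EuclideanSpace ℂ (Fin n) × EuclideanSpace ℂ (Fin k) => f q.1 q.2)
      (P ×ˢ (univ : Set (EuclideanSpace ℂ (Fin k)))))
    (hfsec : ∀ p ∈ P, ∀ x, h (f p x) = x)
    (hfhol : ∀ p ∈ P, Differentiable ℂ (f p)) :
    ∀ U : Set (EuclideanSpace ℂ (Fin n) × EuclideanSpace ℂ (Fin N)), IsOpen U →
      {q : EuclideanSpace ℂ (Fin n) × EuclideanSpace ℂ (Fin N) |
        ∃ p ∈ P, ∃ x ∈ K, q = (p, f p x)} ⊆ U →
      ∃ Θ : Set (EuclideanSpace ℂ (Fin n) × EuclideanSpace ℂ (Fin N)),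
        IsSteinOpen Θ ∧
        {q : EuclideanSpace ℂ (Fin n) × EuclideanSpace ℂ (Fin N) |
          ∃ p ∈ P, ∃ x ∈ K, q = (p, f p x)} ⊆ Θ ∧ Θ ⊆ U ∧
        hullO Θ {q : EuclideanSpace ℂ (Fin n) × EuclideanSpace ℂ (Fin N) |
            ∃ p ∈ P, ∃ x ∈ K, q = (p, f p x)} =
          {q : EuclideanSpace ℂ (Fin n) × EuclideanSpace ℂ (Fin N) |
            ∃ p ∈ P, ∃ x ∈ K, q = (p, f p x)} := by
  intro U hU hSU
  have himg : {q : EuclideanSpace ℂ (Fin n) × EuclideanSpace ℂ (Fin N) |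
        ∃ p ∈ P, ∃ x ∈ K, q = (p, f p x)} = (fun q : EuclideanSpace ℂ (Fin n) ×
        EuclideanSpace ℂ (Fin k) => (q.1, f q.1 q.2)) '' (P ×ˢ K) := by
    ext q
    constructor
    · rintro ⟨p, hp, x, hx, rfl⟩
      exact ⟨(p, x), ⟨hp, hx⟩, rfl⟩
    · rintro ⟨⟨p, x⟩, ⟨hp, hx⟩, rfl⟩
      exact ⟨p, hp, x, hx, rfl⟩
  have hPK : IsCompact (P ×ˢ K) := hPc.prod hK
  have hfc : ContinuousOn (fun q : EuclideanSpace ℂ (Fin n) × EuclideanSpace ℂ (Fin k) =>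
      f q.1 q.2) (P ×ˢ K) := hfcont.mono (prod_mono_right (subset_univ K))
  refine hull_stein_nbhd ?_ ?_ U hU hSU
  · rw [himg]
    exact hPK.image_of_continuousOn (continuousOn_fst.prodMk hfc)
  rintro ⟨q, w⟩ hqw
  by_cases hq : q ∈ realSlice n
  swap
  · -- nonreal base point
    obtain ⟨j, hj⟩ : ∃ j, (q j).im ≠ 0 := by
      by_contra hcon
      push Not at hcon
      exact hq hcon
    have hn : ∀ z : ℂ, ‖Complex.exp (-(z - ((q j).re : ℂ)) ^ 2)‖ =
        Real.exp (z.im ^ 2 - (z.re - (q j).re) ^ 2) := by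
      intro z
      rw [Complex.norm_exp]
      congr 1
      simp [pow_two]
    refine ⟨fun z => Complex.exp (-(z.1 j - ((q j).re : ℂ)) ^ 2), ?_, ?_, ?_⟩
    · fun_prop
    · rintro _ ⟨p, hp, x, hx, rfl⟩
      rw [hn, Real.exp_le_one_iff]
      have : (p j).im = 0 := hPreal hp j
      simp only [this]
      nlinarith [sq_nonneg ((p j).re - (q j).re)]
    · rw [hn, Real.one_lt_exp_iff]
      have : 0 < (q j).im ^ 2 := by positivity
      simpa using this
  · -- real base point
    obtain ⟨g, hg, hgw, hgq⟩ : ∃ g : EuclideanSpace ℂ (Fin N) → ℂ, Differentiable ℂ g ∧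
        1 < ‖g w‖ ∧ (q ∈ P → ∀ x ∈ K, ‖g (f q x)‖ < 1) := by
      by_cases hqP : q ∈ P
      swap
      · exact ⟨fun _ => 2, differentiable_const _, by norm_num, fun h => absurd h hqP⟩
      by_cases hwK : h w ∈ K
      · have hne : w ≠ f q (h w) := by
          intro he
          exact hqw ⟨q, hqP, h w, hwK, by rw [← he]⟩
        obtain ⟨i, hi⟩ : ∃ i, w i - f q (h w) i ≠ 0 := by
          by_contra hcon
          push Not at hcon
          apply hne
          ext i
          exact sub_eq_zero.1 (hcon i)
        have hd := (hfhol q hqP).comp hh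
        refine ⟨fun z => 2 / (w i - f q (h w) i) * (z i - f q (h z) i), ?_, ?_, ?_⟩
        · have hd' : Differentiable ℂ fun z => f q (h z) i :=
            (EuclideanSpace.proj (𝕜 := ℂ) i).differentiable.comp hd
          have hz : Differentiable ℂ fun z : EuclideanSpace ℂ (Fin N) => z i :=
            (EuclideanSpace.proj (𝕜 := ℂ) i).differentiable
          exact (hz.sub hd').const_mul _
        · beta_reduce
          rw [div_mul_cancel₀ _ hi]
          norm_num
        · intro _ x hx
          simp [hfsec q hqP x]
      · have hnot : h w ∉ hullO univ K := by rwa [hKconv]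
        have : ∃ g : EuclideanSpace ℂ (Fin k) → ℂ, DifferentiableOn ℂ g univ ∧
            (⨆ x ∈ K, ‖g x‖) < ‖g (h w)‖ := by
          by_contra hcon
          push Not at hcon
          exact hnot ⟨mem_univ _, hcon⟩
        obtain ⟨g, hg, hlt⟩ := this
        rw [differentiableOn_univ] at hg
        have h0 : 0 ≤ ⨆ x ∈ K, ‖g x‖ :=
          Real.iSup_nonneg fun x => Real.iSup_nonneg fun _ => norm_nonneg _
        obtain ⟨d, hd1, hd2⟩ := exists_between hlt
        have hd0 : (0 : ℝ) < d := by linarith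
        have hn : ∀ w, ‖g w / (d : ℂ)‖ = ‖g w‖ / d := by
          intro w
          rw [norm_div, Complex.norm_real, Real.norm_of_nonneg hd0.le]
        refine ⟨fun z => g (h z) / (d : ℂ), by
          simpa only [div_eq_mul_inv, Function.comp_apply] using (hg.comp hh).mul_const _, ?_, ?_⟩
        · rw [hn, one_lt_div hd0]
          exact hd2
        · intro _ x hx
          rw [hn, div_lt_one hd0, hfsec q hqP x]
          exact lt_of_le_of_lt
            (hull_le_bisup hK (g := fun x => ‖g x‖) hg.continuous.norm.continuousOn hx) hd1
    have hFc : ContinuousOn (fun y : EuclideanSpace ℂ (Fin n) × EuclideanSpace ℂ (Fin k) =>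
        ‖g (f y.1 y.2)‖) (P ×ˢ K) := (hg.continuous.comp_continuousOn hfc).norm
    obtain ⟨M, hM⟩ := hPK.bddAbove_image hFc
    -- the bad set
    have hA : IsCompact ((P ×ˢ K) ∩ (fun y : EuclideanSpace ℂ (Fin n) ×
        EuclideanSpace ℂ (Fin k) => ‖g (f y.1 y.2)‖) ⁻¹' Ici 1) :=
      hPK.of_isClosed_subset (hFc.preimage_isClosed_of_isClosed hPK.isClosed isClosed_Ici)
        inter_subset_left
    obtain ⟨δ, hδ, hδA⟩ : ∃ δ : ℝ, 0 < δ ∧ ∀ p ∈ P, ∀ x ∈ K, 1 ≤ ‖g (f p x)‖ →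
        δ ≤ ‖p - q‖ ^ 2 := by
      rcases ((P ×ˢ K) ∩ (fun y : EuclideanSpace ℂ (Fin n) ×
        EuclideanSpace ℂ (Fin k) => ‖g (f y.1 y.2)‖) ⁻¹' Ici 1).eq_empty_or_nonempty with he | hne
      · refine ⟨1, one_pos, fun p hp x hx h1 => ?_⟩
        have : (p, x) ∈ (∅ : Set (EuclideanSpace ℂ (Fin n) × EuclideanSpace ℂ (Fin k))) := by
          rw [← he]
          exact ⟨⟨hp, hx⟩, h1⟩
        exact absurd this (notMem_empty _)
      · obtain ⟨y, hy, hmin⟩ := hA.exists_isMinOn hne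
          (f := fun y => ‖y.1 - q‖ ^ 2) (by fun_prop)
        refine ⟨‖y.1 - q‖ ^ 2, ?_, fun p hp x hx h1 => ?_⟩
        · have : y.1 - q ≠ 0 := by
            intro h0
            have h0' : y.1 = q := sub_eq_zero.1 h0
            have h1 : 1 ≤ ‖g (f y.1 y.2)‖ := hy.2
            rw [h0'] at h1
            exact absurd (hgq (h0' ▸ hy.1.1) y.2 hy.1.2) (not_lt.2 h1)
          positivity
        · exact isMinOn_iff.1 hmin (p, x) ⟨⟨hp, hx⟩, h1⟩
    have hnorm : ∀ (c : ℝ), ∀ p ∈ realSlice n,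
        ‖Complex.exp (-(c : ℂ) * ∑ j, (p j - q j) ^ 2)‖ = Real.exp (-(c * ‖p - q‖ ^ 2)) := by
      intro c p hp
      have hs : (∑ j, (p j - q j) ^ 2 : ℂ) = ((‖p - q‖ ^ 2 : ℝ) : ℂ) := by
        rw [EuclideanSpace.norm_sq_eq]
        push_cast
        refine Finset.sum_congr rfl fun j _ => ?_
        have him : (p j - q j).im = 0 := by
          rw [Complex.sub_im, hp j, hq j, sub_zero]
        rw [PiLp.sub_apply, ← Complex.conj_mul', Complex.conj_eq_iff_im.2 him, pow_two]
      rw [hs, Complex.norm_exp]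
      congr 1
      rw [← Complex.ofReal_neg, ← Complex.ofReal_mul, Complex.ofReal_re]
      ring
    refine ⟨fun z => Complex.exp (-((|M| / δ : ℝ) : ℂ) * ∑ j, (z.1 j - q j) ^ 2) * g z.2,
      ?_, ?_, ?_⟩
    · have h1 : Differentiable ℂ fun z : EuclideanSpace ℂ (Fin n) × EuclideanSpace ℂ (Fin N) =>
          g z.2 := hg.comp differentiable_snd
      refine Differentiable.mul ?_ h1
      fun_prop
    · rintro _ ⟨p, hp, x, hx, rfl⟩
      rw [norm_mul, hnorm _ p (hPreal hp)]
      by_cases h1 : 1 ≤ ‖g (f p x)‖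
      · have hb := hδA p hp x hx h1
        have hMx : ‖g (f p x)‖ ≤ M := hM ⟨(p, x), ⟨hp, hx⟩, rfl⟩
        have h2 : |M| ≤ |M| / δ * ‖p - q‖ ^ 2 := by
          calc |M| = |M| / δ * δ := by field_simp
            _ ≤ _ := by gcongr
        calc Real.exp (-(|M| / δ * ‖p - q‖ ^ 2)) * ‖g (f p x)‖
            ≤ Real.exp (-|M|) * Real.exp |M| := by
              gcongr
              have := Real.add_one_le_exp |M|
              have := le_abs_self M
              linarith
          _ = 1 := by rw [← Real.exp_add]; simp
      · have h3 : Real.exp (-(|M| / δ * ‖p - q‖ ^ 2)) ≤ 1 := by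
          rw [Real.exp_le_one_iff, neg_nonpos]
          positivity
        exact mul_le_one₀ h3 (norm_nonneg _) (not_le.1 h1).le
    · simpa using hgw
end
end

section
/- Let h : ℂᴺ → ℂᵏ be a holomorphic submersion (entire, with surjective derivative at every point), let K ⊆ ℂᵏ be a compact O(ℂᵏ)-convex set, and let P ⊆ ℝⁿ ⊆ ℂⁿ be compact. Let f : P × ℂᵏ → ℂᴺ be a continuous map such that h(f(p,x)) = x for all (p,x) and such that x ↦ f(p,x) is holomorphic for every p ∈ P, and set Σ = {(p, f(p,x)) : p ∈ P, x ∈ K} ⊆ ℂⁿ × ℂᴺ. Then Σ is O(Θ)-convex in every open Stein set Θ ⊆ ℂⁿ × ℂᴺ containing Σ. -/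
open Set Topology

noncomputable section

theorem le_iSup_of_compact {E : Type*} [TopologicalSpace E] {K : Set E} (hK : IsCompact K)
    {u : E → ℂ} (hu : ContinuousOn u K) {w : E} (hw : w ∈ K) :
    ‖u w‖ ≤ ⨆ w ∈ K, ‖u w‖ := by
  obtain ⟨B, hB⟩ := hK.exists_bound_of_continuousOn hu
  have hb : BddAbove (range (fun w => ⨆ (_ : w ∈ K), ‖u w‖)) := by
    refine ⟨max B 0, ?_⟩
    rintro _ ⟨x, rfl⟩
    exact Real.iSup_le (fun hx => (hB x hx).trans (le_max_left _ _)) (le_max_right _ _)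
  have h1 := le_ciSup hb w
  simpa [hw] using h1

theorem hull_bound {E : Type*} [NormedAddCommGroup E] [NormedSpace ℂ E] {Ω S : Set E} {z : E}
    (hz : z ∈ hullO Ω S) {F : E → ℂ} (hF : Differentiable ℂ F) {M : ℝ} (hM : 0 ≤ M)
    (h : ∀ w ∈ S, ‖F w‖ ≤ M) : ‖F z‖ ≤ M :=
  (hz.2 F hF.differentiableOn).trans
    (Real.iSup_le (fun w => Real.iSup_le (fun hw => h w hw) hM) hM)

theorem peak_norm {n : ℕ} {p a : EuclideanSpace ℂ (Fin n)} (hp : p ∈ realSlice n)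
    (ha : a ∈ realSlice n) :
    ‖Complex.exp (-∑ i, (p i - a i) ^ 2)‖ ≤ 1 ∧
      (p ≠ a → ‖Complex.exp (-∑ i, (p i - a i) ^ 2)‖ < 1) := by
  have key : (-∑ i, (p i - a i) ^ 2).re = -∑ i, ((p i).re - (a i).re) ^ 2 := by
    rw [Complex.neg_re, Complex.re_sum]
    congr 1
    refine Finset.sum_congr rfl fun i _ => ?_
    simp [sq, hp i, ha i]
  rw [Complex.norm_exp, key]
  refine ⟨?_, fun hne => ?_⟩
  · rw [Real.exp_le_one_iff]
    have : 0 ≤ ∑ i, ((p i).re - (a i).re) ^ 2 := Finset.sum_nonneg fun i _ => sq_nonneg _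
    linarith
  · rw [Real.exp_lt_one_iff]
    have : 0 < ∑ i, ((p i).re - (a i).re) ^ 2 := by
      by_contra hcon
      apply hne
      have h0 : ∑ i, ((p i).re - (a i).re) ^ 2 = 0 :=
        le_antisymm (not_lt.mp hcon) (Finset.sum_nonneg fun i _ => sq_nonneg _)
      rw [Finset.sum_eq_zero_iff_of_nonneg (fun i _ => sq_nonneg _)] at h0
      ext i
      have := h0 i (Finset.mem_univ i)
      apply Complex.ext
      · have := pow_eq_zero_iff (two_ne_zero) |>.mp this
        linarith
      · rw [hp i, ha i]
    linarith

/-- Localisation: if `q` is in the hull of a compact set lying over the real slice, and the first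
component of `q` is real, then `q` is controlled by the fiber over that component. -/
theorem hull_fiber {n N : ℕ} {Ω S : Set (EuclideanSpace ℂ (Fin n) × EuclideanSpace ℂ (Fin N))}
    (hS : IsCompact S) (hSr : ∀ w ∈ S, w.1 ∈ realSlice n)
    {z : EuclideanSpace ℂ (Fin n) × EuclideanSpace ℂ (Fin N)}
    (hz : z ∈ hullO Ω S) (hzr : z.1 ∈ realSlice n)
    {F : EuclideanSpace ℂ (Fin n) × EuclideanSpace ℂ (Fin N) → ℂ}
    (hF : Differentiable ℂ F) {M : ℝ} (hM : 0 ≤ M)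
    (h : ∀ w ∈ S, w.1 = z.1 → ‖F w‖ ≤ M) : ‖F z‖ ≤ M := by
  by_contra hcon
  obtain ⟨M', hM1, hM2⟩ := exists_between (not_le.mp hcon)
  set g : EuclideanSpace ℂ (Fin n) × EuclideanSpace ℂ (Fin N) → ℂ :=
    fun w => Complex.exp (-∑ i, (w.1 i - z.1 i) ^ 2) with hg
  have hgd : Differentiable ℂ g := by
    have : ∀ i, Differentiable ℂ
        (fun w : EuclideanSpace ℂ (Fin n) × EuclideanSpace ℂ (Fin N) => w.1 i) := fun i =>
      (EuclideanSpace.proj i : EuclideanSpace ℂ (Fin n) →L[ℂ] ℂ).differentiable.comp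
        differentiable_fst
    fun_prop
  have hgz : g z = 1 := by simp [hg]
  have hC : IsCompact (S ∩ {w | M' ≤ ‖F w‖}) :=
    hS.inter_right (isClosed_le continuous_const hF.continuous.norm)
  obtain ⟨r, hr0, hr1, hr⟩ : ∃ r : ℝ, 0 ≤ r ∧ r < 1 ∧
      ∀ w ∈ S ∩ {w | M' ≤ ‖F w‖}, ‖g w‖ ≤ r := by
    rcases (S ∩ {w | M' ≤ ‖F w‖}).eq_empty_or_nonempty with he | hne
    · exact ⟨0, le_rfl, one_pos, by simp [he]⟩
    · obtain ⟨w, hw, hmax⟩ := hC.exists_isMaxOn hne hgd.continuous.norm.continuousOn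
      refine ⟨‖g w‖, norm_nonneg _, (peak_norm (hSr w hw.1) hzr).2 fun heq => ?_,
        fun v hv => hmax hv⟩
      have h1 := h w hw.1 heq
      have h2 : M' ≤ ‖F w‖ := hw.2
      linarith
  obtain ⟨B, hB⟩ := hS.exists_bound_of_continuousOn hF.continuous.continuousOn
  have hlim : Filter.Tendsto (fun m : ℕ => B * r ^ m) Filter.atTop (𝓝 (B * 0)) :=
    (tendsto_pow_atTop_nhds_zero_of_lt_one hr0 hr1).const_mul B
  rw [mul_zero] at hlim
  obtain ⟨m, hm⟩ := (hlim.eventually_lt_const (hM.trans_lt hM1)).exists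
  have hfin := hull_bound hz (F := fun w => F w * g w ^ m) (hF.mul (hgd.pow m))
    (hM.trans hM1.le) (fun w hw => by
      rw [norm_mul, norm_pow]
      rcases le_or_gt M' ‖F w‖ with h1 | h1
      · refine le_trans ?_ hm.le
        exact mul_le_mul (hB w hw) (pow_le_pow_left₀ (norm_nonneg _) (hr w ⟨hw, h1⟩) m)
          (by positivity) ((norm_nonneg _).trans (hB w hw))
      · refine le_trans ?_ h1.le
        exact mul_le_of_le_one_right (norm_nonneg _)
          (pow_le_one₀ (norm_nonneg _) (peak_norm (hSr w hw) hzr).1))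
  simp only [hgz, one_pow, mul_one] at hfin
  linarith

theorem hull_real {n N : ℕ} {Ω S : Set (EuclideanSpace ℂ (Fin n) × EuclideanSpace ℂ (Fin N))}
    (hSr : ∀ w ∈ S, w.1 ∈ realSlice n)
    {z : EuclideanSpace ℂ (Fin n) × EuclideanSpace ℂ (Fin N)}
    (hz : z ∈ hullO Ω S) : z.1 ∈ realSlice n := by
  intro i
  have hd : Differentiable ℂ
        (fun w : EuclideanSpace ℂ (Fin n) × EuclideanSpace ℂ (Fin N) => w.1 i) :=
      (EuclideanSpace.proj i : EuclideanSpace ℂ (Fin n) →L[ℂ] ℂ).differentiable.comp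
        differentiable_fst
  have h1 := hull_bound hz (F := fun w => Complex.exp (Complex.I * w.1 i)) (by fun_prop)
    zero_le_one (fun w hw => by simp [Complex.norm_exp, hSr w hw i])
  have h2 := hull_bound hz (F := fun w => Complex.exp (-(Complex.I * w.1 i))) (by fun_prop)
    zero_le_one (fun w hw => by simp [Complex.norm_exp, hSr w hw i])
  simp [Complex.norm_exp] at h1 h2
  linarith

/-- The final step of the proof of Corollary 2.3: the laminated graph set
`Σ = {(p, f_p(x)) : p ∈ P, x ∈ K}` is `𝒪(Θ)`-convex in every Stein open set `Θ`
containing it. -/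
theorem laminated_graph_convex_in_every_stein_neighborhood {n k N : ℕ}
    (h : EuclideanSpace ℂ (Fin N) → EuclideanSpace ℂ (Fin k))
    (hh : Differentiable ℂ h)
    (hsub : ∀ z, Function.Surjective (fderiv ℂ h z))
    (K : Set (EuclideanSpace ℂ (Fin k))) (hK : IsCompact K)
    (hKconv : hullO univ K = K)
    (P : Set (EuclideanSpace ℂ (Fin n))) (hPc : IsCompact P) (hPreal : P ⊆ realSlice n)
    (f : EuclideanSpace ℂ (Fin n) → EuclideanSpace ℂ (Fin k) → EuclideanSpace ℂ (Fin N))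
    (hfcont : ContinuousOn
      (fun q : EuclideanSpace ℂ (Fin n) × EuclideanSpace ℂ (Fin k) => f q.1 q.2)
      (P ×ˢ (univ : Set (EuclideanSpace ℂ (Fin k)))))
    (hfsec : ∀ p ∈ P, ∀ x, h (f p x) = x)
    (hfhol : ∀ p ∈ P, Differentiable ℂ (f p)) :
    ∀ Θ : Set (EuclideanSpace ℂ (Fin n) × EuclideanSpace ℂ (Fin N)),
      IsSteinOpen Θ →
      {q : EuclideanSpace ℂ (Fin n) × EuclideanSpace ℂ (Fin N) |
        ∃ p ∈ P, ∃ x ∈ K, q = (p, f p x)} ⊆ Θ →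
      hullO Θ {q : EuclideanSpace ℂ (Fin n) × EuclideanSpace ℂ (Fin N) |
          ∃ p ∈ P, ∃ x ∈ K, q = (p, f p x)} =
        {q : EuclideanSpace ℂ (Fin n) × EuclideanSpace ℂ (Fin N) |
          ∃ p ∈ P, ∃ x ∈ K, q = (p, f p x)} := by

  intro Θ hΘ hsubset
  set S : Set (EuclideanSpace ℂ (Fin n) × EuclideanSpace ℂ (Fin N)) :=
    {q | ∃ p ∈ P, ∃ x ∈ K, q = (p, f p x)} with hSdef
  have hS : IsCompact S := by
    have : S = (fun q : EuclideanSpace ℂ (Fin n) × EuclideanSpace ℂ (Fin k) =>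
        (q.1, f q.1 q.2)) '' (P ×ˢ K) := by
      ext q
      constructor
      · rintro ⟨p, hp, x, hx, rfl⟩
        exact ⟨(p, x), ⟨hp, hx⟩, rfl⟩
      · rintro ⟨⟨p, x⟩, ⟨hp, hx⟩, rfl⟩
        exact ⟨p, hp, x, hx, rfl⟩
    rw [this]
    exact (hPc.prod hK).image_of_continuousOn (continuousOn_fst.prodMk
      (hfcont.mono (prod_mono le_rfl (subset_univ _))))
  have hSr : ∀ w ∈ S, w.1 ∈ realSlice n := by
    rintro _ ⟨p, hp, x, _, rfl⟩
    exact hPreal hp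
  apply Subset.antisymm
  · intro z hz
    have hzr := hull_real hSr hz
    have hp : z.1 ∈ P := by
      by_contra hcon
      have := hull_fiber hS hSr hz hzr (F := fun _ => 1) (by fun_prop) le_rfl (by
        rintro _ ⟨p, hp, x, _, rfl⟩ heq
        exact absurd (heq ▸ hp) hcon)
      norm_num at this
    have hhd : Differentiable ℂ
        (fun w : EuclideanSpace ℂ (Fin n) × EuclideanSpace ℂ (Fin N) => h w.2) :=
      hh.comp differentiable_snd
    have hx : h z.2 ∈ K := by
      rw [← hKconv]
      refine ⟨mem_univ _, fun u hu => ?_⟩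
      rw [differentiableOn_univ] at hu
      refine hull_fiber hS hSr hz hzr (F := fun w => u (h w.2)) (hu.comp hhd)
        (Real.iSup_nonneg fun w => Real.iSup_nonneg fun _ => norm_nonneg _) ?_
      rintro _ ⟨p, hp, x, hx, rfl⟩ _
      simp only [hfsec p hp x]
      exact le_iSup_of_compact hK hu.continuous.continuousOn hx
    have hf : z.2 = f z.1 (h z.2) := by
      ext i
      have hd : Differentiable ℂ
          (fun w : EuclideanSpace ℂ (Fin n) × EuclideanSpace ℂ (Fin N) =>
            (w.2 - f z.1 (h w.2)) i) :=
        (EuclideanSpace.proj i : EuclideanSpace ℂ (Fin N) →L[ℂ] ℂ).differentiable.comp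
          (differentiable_snd.sub ((hfhol _ hp).comp hhd))
      have := hull_fiber hS hSr hz hzr hd le_rfl (by
        rintro _ ⟨p, hp, x, hx, rfl⟩ heq
        simp only at heq
        subst heq
        simp [hfsec _ hp x])
      have := norm_le_zero_iff.mp this
      exact sub_eq_zero.mp this
    exact ⟨z.1, hp, h z.2, hx, Prod.ext rfl hf⟩
  · intro w hw
    exact ⟨hsubset hw, fun u hu =>
      le_iSup_of_compact hS (hu.continuousOn.mono hsubset) hw⟩
end
end
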